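/- Let n = 2m and let F : F_{2^n} → F_{2^n} satisfy F(x^2) = F(x)^2 for all x and #S_F = 2^m, and assume ℓ(n) > m. Then the nonlinearity of F satisfies 𝒩_F ≤ 2^{n−1} − (1/2)·√(2^n·(2^m + 2)). -/

import Mathlib

open Finset

/-- The Walsh transform `W_{F_a}(ω) = Σ_v (−1)^{Tr(a·F(v)) + Tr(ω·v)}`. -/
noncomputable def walsh {K : Type*} [Field K] [Fintype K] [Algebra (ZMod 2) K]
    (F : K → K) (a ω : K) : ℤ :=
  ∑ v : K, if Algebra.trace (ZMod 2) K (a * F v) + Algebra.trace (ZMod 2) K (ω * v) = 0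
    then 1 else -1

/-- The component `F_a` is bent: all Walsh values are `±2^m`. -/
def IsBent {K : Type*} [Field K] [Fintype K] [Algebra (ZMod 2) K]
    (m : ℕ) (F : K → K) (a : K) : Prop :=
  ∀ ω : K, walsh F a ω = 2 ^ m ∨ walsh F a ω = -(2 ^ m)

/-- The `F₂`-span of the Frobenius orbit `{γ, γ², γ⁴, …}` of `γ`. -/
def frobSpan (K : Type*) [Field K] [Algebra (ZMod 2) K] (γ : K) : Submodule (ZMod 2) K :=
  Submodule.span (ZMod 2) (Set.range fun i : ℕ => γ ^ (2 ^ i))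

/-- The nonlinearity `𝒩_F = 2^{n−1} − (1/2)·max{|W_{F_a}(ω)| : a ≠ 0, ω}`. -/
noncomputable def nonlinearity {K : Type*} [Field K] [Fintype K] [Algebra (ZMod 2) K]
    (n : ℕ) (F : K → K) : ℝ :=
  2 ^ (n - 1) - (1 / 2) *
    (⨆ a : {a : K // a ≠ 0}, ⨆ ω : K, (|walsh F (a : K) ω| : ℝ))

/-- The canonical additive character `x ↦ (−1)^{Tr x}`. -/
noncomputable def traceSign {K : Type*} [Field K] [Algebra (ZMod 2) K] (x : K) : ℤ :=
  if Algebra.trace (ZMod 2) K x = 0 then 1 else -1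

section WalshMoments

variable {K : Type*} [Field K] [Algebra (ZMod 2) K]

theorem traceSign_add (x y : K) : traceSign (x + y) = traceSign x * traceSign y := by
  unfold traceSign
  rw [map_add]
  generalize Algebra.trace (ZMod 2) K x = s
  generalize Algebra.trace (ZMod 2) K y = t
  revert s t
  decide

theorem traceSign_mul_self (x : K) : traceSign x * traceSign x = 1 := by
  unfold traceSign
  split_ifs <;> rfl

theorem add_eq_zero_iff_eq_of_algebra_zmod_two (x y : K) : x + y = 0 ↔ y = x := by
  have : CharP K 2 := charP_of_injective_algebraMap (algebraMap (ZMod 2) K).injective 2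
  rw [CharTwo.add_eq_zero, eq_comm]

variable [Fintype K]

theorem sum_traceSign [DecidableEq K] (x : K) :
    ∑ a : K, traceSign (a * x) = if x = 0 then (Fintype.card K : ℤ) else 0 := by
  split_ifs with hx
  · simp [hx, traceSign]
  · obtain ⟨b, hb⟩ := Algebra.trace_surjective (ZMod 2) K 1
    have hsign : traceSign b = -1 := by simp [traceSign, hb]
    have hshift : ∑ a : K, traceSign ((a + b / x) * x) = ∑ a : K, traceSign (a * x) :=
      Equiv.sum_comp (Equiv.addRight (b / x)) fun a => traceSign (a * x)
    simp only [add_mul, div_mul_cancel₀ b hx, traceSign_add, hsign, mul_neg, mul_one,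
      sum_neg_distrib] at hshift
    linarith

theorem walsh_eq_sum_traceSign (F : K → K) (a ω : K) :
    walsh F a ω = ∑ v : K, traceSign (a * F v) * traceSign (ω * v) := by
  simp only [← traceSign_add]
  simp only [walsh, traceSign, map_add]

theorem walsh_zero_left [DecidableEq K] (F : K → K) (ω : K) :
    walsh F 0 ω = if ω = 0 then (Fintype.card K : ℤ) else 0 := by
  rw [walsh_eq_sum_traceSign, ← sum_traceSign ω]
  simp [traceSign, mul_comm]

theorem sum_walsh_sq (F : K → K) (a : K) :
    ∑ ω : K, walsh F a ω ^ 2 = (Fintype.card K : ℤ) ^ 2 := by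
  classical
  calc ∑ ω : K, walsh F a ω ^ 2
      = ∑ ω : K, ∑ x : K, ∑ y : K,
          traceSign (a * F x) * traceSign (a * F y) * traceSign (ω * (x + y)) := by
        refine sum_congr rfl fun ω _ => ?_
        rw [walsh_eq_sum_traceSign, sq, sum_mul_sum]
        refine sum_congr rfl fun x _ => sum_congr rfl fun y _ => ?_
        rw [mul_add, traceSign_add]
        ring
    _ = ∑ x : K, ∑ y : K, ∑ ω : K,
          traceSign (a * F x) * traceSign (a * F y) * traceSign (ω * (x + y)) := by
        rw [sum_comm]
        exact sum_congr rfl fun x _ => sum_comm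
    _ = (Fintype.card K : ℤ) ^ 2 := by
        simp only [← mul_sum, sum_traceSign, add_eq_zero_iff_eq_of_algebra_zmod_two, mul_ite,
          mul_zero, sum_ite_eq', mem_univ, if_true, traceSign_mul_self]
        simp [sq]

theorem sum_walsh_pow_four (F : K → K) (a : K) :
    ∑ ω : K, walsh F a ω ^ 4 = Fintype.card K *
      ∑ x : K, ∑ y : K, ∑ z : K, traceSign (a * (F x + F y + F z + F (x + y + z))) := by
  classical
  calc ∑ ω : K, walsh F a ω ^ 4
      = ∑ ω : K, ∑ x : K, ∑ y : K, ∑ z : K, ∑ t : K,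
          traceSign (a * (F x + F y + F z + F t)) * traceSign (ω * (x + y + z + t)) := by
        refine sum_congr rfl fun ω _ => ?_
        rw [walsh_eq_sum_traceSign, show ∀ s : ℤ, s ^ 4 = s * (s * (s * s)) from fun s => by ring]
        simp only [sum_mul_sum]
        simp only [mul_sum]
        refine sum_congr rfl fun x _ => sum_congr rfl fun y _ => sum_congr rfl fun z _ =>
          sum_congr rfl fun t _ => ?_
        simp only [mul_add, traceSign_add]
        ring
    _ = ∑ x : K, ∑ y : K, ∑ z : K, ∑ t : K, ∑ ω : K,
          traceSign (a * (F x + F y + F z + F t)) * traceSign (ω * (x + y + z + t)) := by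
        rw [sum_comm]
        refine sum_congr rfl fun x _ => ?_
        rw [sum_comm]
        refine sum_congr rfl fun y _ => ?_
        rw [sum_comm]
        exact sum_congr rfl fun z _ => sum_comm
    _ = _ := by
        simp only [← mul_sum, sum_traceSign, add_eq_zero_iff_eq_of_algebra_zmod_two, mul_ite,
          mul_zero, sum_ite_eq', mem_univ, if_true]
        simp only [mul_sum, mul_comm]

/-- The fourth moment is bounded below by counting the trivial solutions of
`F x + F y + F z + F (x + y + z) = 0`. -/
theorem le_sum_sum_walsh_pow_four (F : K → K) :
    (Fintype.card K : ℤ) ^ 2 * (3 * (Fintype.card K : ℤ) ^ 2 - 2 * Fintype.card K) ≤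
      ∑ a : K, ∑ ω : K, walsh F a ω ^ 4 := by
  classical
  have : CharP K 2 := charP_of_injective_algebraMap (algebraMap (ZMod 2) K).injective 2
  have hswap : ∑ a : K, ∑ ω : K, walsh F a ω ^ 4 = Fintype.card K *
      ∑ x : K, ∑ y : K, ∑ z : K,
        if F x + F y + F z + F (x + y + z) = 0 then (Fintype.card K : ℤ) else 0 := by
    simp only [sum_walsh_pow_four, ← mul_sum, ← sum_traceSign]
    congr 1
    rw [sum_comm]
    refine sum_congr rfl fun x _ => ?_
    rw [sum_comm]
    exact sum_congr rfl fun y _ => sum_comm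
  have hcount : ∑ x : K, ∑ y : K, ∑ z : K, (Fintype.card K : ℤ) *
      ((if y = x then 1 else 0) + (if z = x then 1 else 0) + (if z = y then 1 else 0)
        - 2 * (if y = x then if z = x then 1 else 0 else 0)) =
      (Fintype.card K : ℤ) * (3 * (Fintype.card K : ℤ) ^ 2 - 2 * Fintype.card K) := by
    simp only [← mul_sum, sum_add_distrib, sum_sub_distrib]
    congr 1
    have hdiag : ∀ x : K, ∑ y : K, ∑ z : K,
        (if y = x then if z = x then (1 : ℤ) else 0 else 0) = 1 := fun x => by
      rw [sum_eq_single x (fun y _ hy => by simp [hy]) (by simp)]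
      simp
    simp only [hdiag]
    simp
    ring
  rw [hswap, sq (Fintype.card K : ℤ), mul_assoc, ← sq, ← hcount]
  refine mul_le_mul_of_nonneg_left ?_ (by positivity)
  refine sum_le_sum fun x _ => sum_le_sum fun y _ => sum_le_sum fun z _ => ?_
  have hq : (0 : ℤ) ≤ Fintype.card K := by positivity
  by_cases hxy : y = x
  · subst hxy
    have h : F y + F y + F z + F (y + y + z) = 0 := by simp [CharTwo.add_self_eq_zero]
    rw [if_pos h]
    split_ifs <;> simp_all
  by_cases hxz : z = x
  · subst hxz
    have h : F z + F y + F z + F (z + y + z) = 0 := by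
      rw [add_right_comm z y z, add_right_comm (F z)]
      simp [CharTwo.add_self_eq_zero]
    rw [if_pos h]
    simp [hxy, Ne.symm hxy]
  by_cases hyz : z = y
  · subst hyz
    have h : F x + F z + F z + F (x + z + z) = 0 := by
      simp [add_assoc, CharTwo.add_self_eq_zero]
    rw [if_pos h]
    simp [hxy]
  · simp only [hxy, hxz, hyz, if_false]
    split_ifs <;> simp

theorem IsBent.walsh_sq {m : ℕ} {F : K → K} {a : K} (h : IsBent m F a) (ω : K) :
    walsh F a ω ^ 2 = (2 ^ m) ^ 2 := by
  rcases h ω with h | h <;> simp [h]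

theorem sum_walsh_pow_four_le (F : K → K) (a : K) (B : ℤ) (hB : ∀ ω, walsh F a ω ^ 2 ≤ B) :
    ∑ ω : K, walsh F a ω ^ 4 ≤ B * (Fintype.card K : ℤ) ^ 2 := by
  rw [← sum_walsh_sq F a, mul_sum]
  refine sum_le_sum fun ω _ => ?_
  rw [show walsh F a ω ^ 4 = walsh F a ω ^ 2 * walsh F a ω ^ 2 by ring]
  exact mul_le_mul_of_nonneg_right (hB ω) (sq_nonneg _)

/-- If exactly `2^m` components are not bent, some nonzero component has a large Walsh value. -/
theorem exists_le_walsh_sq {m : ℕ} (hm : 0 < m) (hcard : Fintype.card K = 2 ^ (2 * m))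
    (F : K → K) (hSF : Set.ncard {a : K | ¬ IsBent m F a} = 2 ^ m) :
    ∃ a : K, a ≠ 0 ∧ ∃ ω : K, (2 : ℤ) ^ (2 * m) * (2 ^ m + 2) ≤ walsh F a ω ^ 2 := by
  classical
  by_contra! hlt
  set P : ℤ := 2 ^ m with hP
  have hP2 : 2 ≤ P := by
    calc (2 : ℤ) = 2 ^ 1 := by norm_num
      _ ≤ 2 ^ m := pow_le_pow_right₀ (by norm_num) hm
  have hq : (Fintype.card K : ℤ) = P ^ 2 := by
    rw [hcard, hP]
    push_cast
    ring
  have hq' : (2 : ℤ) ^ (2 * m) = P ^ 2 := by rw [hP]; ring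
  set S : Finset K := univ.filter fun a => ¬ IsBent m F a with hS
  have hScard : (S.card : ℤ) = P := by
    have : S.card = 2 ^ m := by rw [← hSF, ← Set.ncard_coe_finset]; simp [hS]
    rw [this, hP]
    push_cast
    rfl
  have hzero : (0 : K) ∈ S := by
    simp only [hS, mem_filter, mem_univ, true_and]
    intro h
    have := h.walsh_sq 0
    rw [walsh_zero_left, if_pos rfl, hq, ← hP] at this
    have hsq : 4 ≤ P ^ 2 := by nlinarith
    nlinarith
  have hbent : ∑ a ∈ univ \ S, ∑ ω : K, walsh F a ω ^ 4 ≤ (P ^ 2 - P) * (P ^ 2 * (P ^ 2) ^ 2) := by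
    have hc : ((univ \ S).card : ℤ) = P ^ 2 - P := by
      rw [card_sdiff_of_subset (subset_univ S), card_univ, Nat.cast_sub (card_le_univ S), hScard,
        hq]
    rw [← hc, ← nsmul_eq_mul]
    refine sum_le_card_nsmul _ _ _ fun a ha => ?_
    have hb : IsBent m F a := by simpa [hS] using ha
    simpa only [hq] using sum_walsh_pow_four_le F a (P ^ 2) fun ω => (hb.walsh_sq ω).le
  have hnonbent : ∑ a ∈ S.erase 0, ∑ ω : K, walsh F a ω ^ 4 ≤
      (P - 1) * ((P ^ 2 * (P + 2) - 1) * (P ^ 2) ^ 2) := by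
    have hc : ((S.erase 0).card : ℤ) = P - 1 := by
      rw [card_erase_of_mem hzero, Nat.cast_sub (card_pos.mpr ⟨0, hzero⟩), hScard, Nat.cast_one]
    rw [← hc, ← nsmul_eq_mul]
    refine sum_le_card_nsmul _ _ _ fun a ha => ?_
    have h := sum_walsh_pow_four_le F a (P ^ 2 * (P + 2) - 1) fun ω => by
      have := hlt a (ne_of_mem_erase ha) ω
      rw [hq'] at this
      linarith
    simpa only [hq] using h
  have htriv : ∑ ω : K, walsh F 0 ω ^ 4 = (P ^ 2) ^ 4 := by
    simp [walsh_zero_left, ite_pow, hq]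
  have htotal := le_sum_sum_walsh_pow_four F
  rw [hq, ← sum_sdiff (subset_univ S), ← add_sum_erase S _ hzero, htriv] at htotal
  have hpos : 0 < (P - 1) * (P ^ 2) ^ 2 := by
    have : 0 < P - 1 := by linarith
    positivity
  linarith

end WalshMoments


/-- Let `n = 2m`, `F : F_{2^n} → F_{2^n}` commute with the Frobenius, `#S_F = 2^m`, and
`ℓ(n) > m`.  Then `𝒩_F ≤ 2^{n−1} − (1/2)·√(2^n·(2^m + 2))`. -/
theorem stmt14 (m n : ℕ) (hm : 0 < m) (hn : n = 2 * m)
    (K : Type*) [Field K] [Fintype K] [Algebra (ZMod 2) K]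
    (hcard : Fintype.card K = 2 ^ n)
    (F : K → K) (hcomm : ∀ x, F (x ^ 2) = (F x) ^ 2)
    (hSF : Set.ncard {a : K | ¬ IsBent m F a} = 2 ^ m)
    (hell : ∀ γ : K, Subfield.closure {γ} = ⊤ →
      m < Module.finrank (ZMod 2) (frobSpan K γ)) :
    nonlinearity n F ≤ 2 ^ (n - 1) - (1 / 2) * Real.sqrt (2 ^ n * (2 ^ m + 2)) := by
  subst hn
  obtain ⟨a, ha, ω, hω⟩ := exists_le_walsh_sq hm hcard F hSF
  have hsqrt : Real.sqrt (2 ^ (2 * m) * (2 ^ m + 2)) ≤ |(walsh F a ω : ℝ)| := by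
    rw [← Real.sqrt_sq_eq_abs]
    exact Real.sqrt_le_sqrt (by exact_mod_cast hω)
  have hsup : |(walsh F a ω : ℝ)| ≤
      ⨆ a : {a : K // a ≠ 0}, ⨆ ω : K, |(walsh F (a : K) ω : ℝ)| :=
    (le_ciSup (f := fun ω : K => |(walsh F a ω : ℝ)|) (Set.finite_range _).bddAbove ω).trans
      (le_ciSup (f := fun a : {a : K // a ≠ 0} => ⨆ ω : K, |(walsh F (a : K) ω : ℝ)|)
        (Set.finite_range _).bddAbove ⟨a, ha⟩)
  unfold nonlinearity
  linarith
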